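/- arXiv:1811.02161 — 2 statements merged into one kernel-verified Lean document; each statement's English description precedes it below -/
import Mathlib

section
/- Let N ≥ 1, let K̃ be a real symmetric positive semidefinite N×N matrix with unit diagonal (K̃_{kk} = 1 for all k), let C > 0, let p ∈ [0, 1/2], and let γ = (γ_1, …, γ_N) be independent random variables each taking the value 1 with probability p, the value −1 with probability p, and the value 0 with probability 1−2p. Then (1/N) · E[ sup_{β ∈ ℝ^N, ‖β‖_∞ ≤ C} βᵀ K̃ γ ] ≤ C √(2 p · λ1(K̃)), where λ1(K̃) is the largest eigenvalue of K̃. -/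
noncomputable section
open Finset Matrix

/-- The three possible outcomes of a transductive-Rademacher variable have
probabilities `p`, `p`, `1 - 2p` ... -/
def radW (p : ℝ) : Fin 3 → ℝ := ![p, p, 1 - 2 * p]

/-- ... and values `1`, `-1`, `0` respectively. -/
def radV : Fin 3 → ℝ := ![1, -1, 0]

/-- Expectation of `h γ` where `γ = (γ_1, …, γ_N)` (indexed by `ι`) is a vector of i.i.d.
random variables taking value `1` w.p. `p`, `-1` w.p. `p` and `0` w.p. `1 - 2p`. -/
def radExp {ι : Type*} [Fintype ι] [DecidableEq ι] (p : ℝ) (h : (ι → ℝ) → ℝ) : ℝ :=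
  ∑ g : ι → Fin 3, (∏ k, radW p (g k)) * h (fun k => radV (g k))


-- The largest eigenvalue of a real symmetric matrix
-- (junk value `0` if the matrix is not symmetric).
open scoped Classical in
noncomputable def lam1 {ι : Type*} [Fintype ι] [DecidableEq ι] (M : Matrix ι ι ℝ) : ℝ :=
  if h : M.IsHermitian then ⨆ i, h.eigenvalues i else 0

theorem sum_prod_radW {ι : Type*} [Fintype ι] [DecidableEq ι] (p : ℝ) :
    ∑ g : ι → Fin 3, ∏ k, radW p (g k) = 1 := by
  rw [← Fintype.prod_sum fun (_ : ι) a => radW p a]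
  refine Finset.prod_eq_one fun k _ => ?_
  simp [Fin.sum_univ_three, radW]
  ring

theorem radW_nonneg {p : ℝ} (hp0 : 0 ≤ p) (hp : p ≤ 1 / 2) (a : Fin 3) : 0 ≤ radW p a := by
  fin_cases a <;> simp [radW] <;> linarith

theorem radExp_mono {ι : Type*} [Fintype ι] [DecidableEq ι] {p : ℝ} (hp0 : 0 ≤ p)
    (hp : p ≤ 1 / 2) {f h : (ι → ℝ) → ℝ} (hfh : ∀ γ, f γ ≤ h γ) :
    radExp p f ≤ radExp p h :=
  Finset.sum_le_sum fun _ _ => mul_le_mul_of_nonneg_left (hfh _)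
    (Finset.prod_nonneg fun _ _ => radW_nonneg hp0 hp _)

theorem radExp_const_mul {ι : Type*} [Fintype ι] [DecidableEq ι] (p c : ℝ)
    (f : (ι → ℝ) → ℝ) : radExp p (fun γ => c * f γ) = c * radExp p f := by
  simp only [radExp, Finset.mul_sum]
  exact Finset.sum_congr rfl fun _ _ => by ring

theorem radExp_sum {ι κ : Type*} [Fintype ι] [DecidableEq ι] (p : ℝ) (s : Finset κ)
    (f : κ → (ι → ℝ) → ℝ) :
    radExp p (fun γ => ∑ i ∈ s, f i γ) = ∑ i ∈ s, radExp p (f i) := by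
  simp only [radExp, Finset.mul_sum]
  exact Finset.sum_comm

/-- Jensen's inequality for the square. -/
theorem radExp_sq_le {ι : Type*} [Fintype ι] [DecidableEq ι] {p : ℝ} (hp0 : 0 ≤ p)
    (hp : p ≤ 1 / 2) (f : (ι → ℝ) → ℝ) :
    radExp p f ^ 2 ≤ radExp p (fun γ => f γ ^ 2) :=
  Real.pow_arith_mean_le_arith_mean_pow_of_even Finset.univ _ _
    (fun _ _ => Finset.prod_nonneg fun _ _ => radW_nonneg hp0 hp _)
    (sum_prod_radW p) even_two

theorem radExp_mul_apply {ι : Type*} [Fintype ι] [DecidableEq ι] (p : ℝ) (i j : ι) :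
    radExp p (fun γ => γ i * γ j) = if i = j then 2 * p else 0 := by
  have key : radExp p (fun γ : ι → ℝ => γ i * γ j) = ∏ k : ι, ∑ a : Fin 3,
      radW p a * ((if k = i then radV a else 1) * (if k = j then radV a else 1)) := by
    rw [Fintype.prod_sum]
    refine Finset.sum_congr rfl fun g _ => ?_
    rw [Finset.prod_mul_distrib, Finset.prod_mul_distrib]
    simp
  rw [key]
  split_ifs with h
  · subst h
    rw [Finset.prod_eq_single i]
    · simp [Fin.sum_univ_three, radW, radV]
      ring
    · intro k _ hk
      simp [Fin.sum_univ_three, radW, hk]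
      ring
    · simp
  · refine Finset.prod_eq_zero (Finset.mem_univ i) ?_
    simp [Fin.sum_univ_three, radW, radV, h]

theorem radExp_dotProduct_sq {ι : Type*} [Fintype ι] [DecidableEq ι] (p : ℝ) (a : ι → ℝ) :
    radExp p (fun γ => (a ⬝ᵥ γ) ^ 2) = 2 * p * ∑ i, a i ^ 2 := by
  have h (γ : ι → ℝ) : (a ⬝ᵥ γ) ^ 2 = ∑ i, ∑ j, a i * a j * (γ i * γ j) := by
    rw [dotProduct, sq, Finset.sum_mul_sum]
    exact Finset.sum_congr rfl fun i _ => Finset.sum_congr rfl fun j _ => by ring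
  simp only [h, radExp_sum, radExp_const_mul, radExp_mul_apply, mul_ite, mul_zero,
    Finset.sum_ite_eq, Finset.mem_univ, if_true, Finset.mul_sum]
  exact Finset.sum_congr rfl fun i _ => by ring

theorem trace_mul_self_eq_sum_eigenvalues_sq {ι : Type*} [Fintype ι] [DecidableEq ι]
    {M : Matrix ι ι ℝ} (hM : M.IsHermitian) :
    (M * M).trace = ∑ i, hM.eigenvalues i ^ 2 := by
  conv_lhs => rw [hM.spectral_theorem, ← map_mul, Unitary.conjStarAlgAut_apply,
    Matrix.trace_mul_cycle]
  simp [Matrix.diagonal_mul_diagonal, Matrix.trace_diagonal, sq]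

theorem trace_mul_self_le_lam1_mul_trace {ι : Type*} [Fintype ι] [DecidableEq ι]
    {M : Matrix ι ι ℝ} (hM : M.PosSemidef) : (M * M).trace ≤ lam1 M * M.trace := by
  have hH := hM.isHermitian
  rw [trace_mul_self_eq_sum_eigenvalues_sq hH, hH.trace_eq_sum_eigenvalues, lam1, dif_pos hH,
    Finset.mul_sum]
  refine Finset.sum_le_sum fun i _ => ?_
  rw [sq]
  exact mul_le_mul_of_nonneg_right (le_ciSup (Set.finite_range _).bddAbove i)
    (hM.eigenvalues_nonneg i)

theorem sSup_dotProduct_le {ι : Type*} [Fintype ι] {C : ℝ} (hC : 0 ≤ C) (v : ι → ℝ) :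
    sSup {x : ℝ | ∃ β : ι → ℝ, (∀ k, |β k| ≤ C) ∧ x = β ⬝ᵥ v} ≤ C * ∑ k, |v k| := by
  refine Real.sSup_le ?_ (by positivity)
  rintro x ⟨β, hβ, rfl⟩
  rw [dotProduct, Finset.mul_sum]
  refine Finset.sum_le_sum fun k _ => (le_abs_self _).trans ?_
  rw [abs_mul]
  exact mul_le_mul_of_nonneg_right (hβ k) (abs_nonneg _)

/-- The expected `ℓ¹` norm of `M γ` is controlled by the Frobenius norm of `M`. -/
theorem radExp_sum_abs_sq_le {ι : Type*} [Fintype ι] [DecidableEq ι] {p : ℝ} (hp0 : 0 ≤ p)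
    (hp : p ≤ 1 / 2) (M : Matrix ι ι ℝ) :
    radExp p (fun γ => ∑ k, |(M *ᵥ γ) k|) ^ 2
      ≤ Fintype.card ι * (2 * p * (M * Mᵀ).trace) := by
  calc radExp p (fun γ => ∑ k, |(M *ᵥ γ) k|) ^ 2
      ≤ radExp p (fun γ => (∑ k, |(M *ᵥ γ) k|) ^ 2) := radExp_sq_le hp0 hp _
    _ ≤ radExp p (fun γ => Fintype.card ι * ∑ k, (M k ⬝ᵥ γ) ^ 2) :=
        radExp_mono hp0 hp fun γ => by
          simpa [Matrix.mulVec] using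
            sq_sum_le_card_mul_sum_sq (s := Finset.univ) (f := fun k => |(M *ᵥ γ) k|)
    _ = Fintype.card ι * (2 * p * (M * Mᵀ).trace) := by
        simp only [radExp_const_mul, radExp_sum, radExp_dotProduct_sq, ← Finset.mul_sum]
        simp [Matrix.trace, Matrix.mul_apply, sq]

/-- transductive Rademacher complexity bound
`(1/N) E[sup_{‖β‖_∞ ≤ C} βᵀ K̃ γ] ≤ C √(2p λ1(K̃))` for `K̃` symmetric PSD with
unit diagonal. -/
theorem stmt_3 (N : ℕ) (hN : 1 ≤ N) (Ktil : Matrix (Fin N) (Fin N) ℝ)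
    (hK : Ktil.PosSemidef) (hdiag : ∀ k, Ktil k k = 1)
    (C p : ℝ) (hC : 0 < C) (hp0 : 0 ≤ p) (hp : p ≤ 1 / 2) :
    (1 / (N : ℝ)) * radExp p (fun γ =>
        sSup {x : ℝ | ∃ β : Fin N → ℝ, (∀ k, |β k| ≤ C) ∧ x = β ⬝ᵥ (Ktil *ᵥ γ)})
      ≤ C * Real.sqrt (2 * p * lam1 Ktil) := by
  have hN' : (0 : ℝ) < N := by exact_mod_cast hN
  have htr : Ktil.trace = N := by simp [Matrix.trace, hdiag]
  have hT : Ktilᵀ = Ktil := by simpa using hK.isHermitian.eq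
  have hsq := radExp_sum_abs_sq_le hp0 hp Ktil
  rw [hT, Fintype.card_fin] at hsq
  have hfrob := trace_mul_self_le_lam1_mul_trace hK
  rw [htr] at hfrob
  have hE : radExp p (fun γ => ∑ k, |(Ktil *ᵥ γ) k|) ≤ N * Real.sqrt (2 * p * lam1 Ktil) := by
    rw [← div_le_iff₀' hN']
    refine Real.le_sqrt_of_sq_le ?_
    rw [div_pow, div_le_iff₀ (by positivity)]
    calc _ ≤ (N : ℝ) * (2 * p * (Ktil * Ktil).trace) := hsq
      _ ≤ N * (2 * p * (lam1 Ktil * N)) := by gcongr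
      _ = 2 * p * lam1 Ktil * (N : ℝ) ^ 2 := by ring
  have hS := radExp_mono hp0 hp fun γ => sSup_dotProduct_le hC.le (Ktil *ᵥ γ)
  rw [radExp_const_mul] at hS
  rw [one_div_mul_eq_div, div_le_iff₀' hN']
  calc _ ≤ _ := hS
    _ ≤ C * (N * Real.sqrt (2 * p * lam1 Ktil)) := by gcongr
    _ = _ := by ring
end
end

section
/- There exists a universal constant C₁ > 0 with the following property. Let G be a finite simple graph on vertex set {1,…,n} (n ≥ 3) with edge set E, let K ∈ 𝒦(G), let 𝒫_n = {(i,j) : 1 ≤ i < j ≤ n}, N = n(n−1)/2, and let K̃ be the N×N principal submatrix of the Kronecker product K⊗K whose rows and columns are indexed by 𝒫_n. Let y ∈ {−1,1}^N, f ∈ (0, 1/2], m = ⌈Nf⌉ with m < N, C > 0, and consider the class ℱ = {K̃β : β ∈ ℝ^N, ‖β‖_∞ ≤ C}. Let ρ > 0, B > 0 and ℓ : {−1,1} × ℝ → [0, B] satisfy |ℓ(y, t) − ℓ(y, t')| ≤ (1/ρ)|t − t'|. Then for every δ ∈ (0,1), with probability at least 1 − δ over a uniformly random subset S ⊆ 𝒫_n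 of size m, for all F ∈ ℱ: (1/(N−m)) Σ_{k ∉ S} ℓ(y_k, F_k) ≤ (1/m) Σ_{k ∈ S} ℓ(y_k, F_k) + √2 · C · λ1(K) / (ρ √(f(1−f))) + C₁ B (1 + √(ln(1/δ))) / ((1−f)√(Nf)). -/
noncomputable section
open Finset Matrix Kronecker
open scoped Classical

/-- `𝒦(G)`: the set of symmetric PSD matrices with unit diagonal whose
off-diagonal entries vanish on non-edges of `G` (Gram matrices of orthonormal
representations of `G`). -/
def gramSet {n : ℕ} (G : SimpleGraph (Fin n)) : Set (Matrix (Fin n) (Fin n) ℝ) :=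
  {K | K.PosSemidef ∧ (∀ i, K i i = 1) ∧ ∀ i j, i ≠ j → ¬ G.Adj i j → K i j = 0}

/-- `𝒫_n`: the set of pairs `(i, j)` with `1 ≤ i < j ≤ n`. -/
abbrev Pairs (n : ℕ) := {q : Fin n × Fin n // q.1 < q.2}

/-- Choosing an `(m+1)`-subset with a marked element is the same as choosing an element and then
an `m`-subset of the rest. -/
theorem succ_mul_sum_powersetCard_succ {V : Type*} [DecidableEq V] (A : Finset V) (m : ℕ) (G : Finset V → ℝ) :
    ((m : ℝ) + 1) * ∑ S ∈ powersetCard (m + 1) A, G S =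
      ∑ x ∈ A, ∑ S ∈ powersetCard m (A.erase x), G (insert x S) := by
  have h1 : ((m : ℝ) + 1) * ∑ S ∈ powersetCard (m + 1) A, G S =
      ∑ S ∈ powersetCard (m + 1) A, ∑ _x ∈ S, G S := by
    rw [Finset.mul_sum]
    refine Finset.sum_congr rfl fun S hS => ?_
    rw [Finset.sum_const, (mem_powersetCard.1 hS).2]
    simp
  rw [h1, Finset.sum_sigma', Finset.sum_sigma']
  refine Finset.sum_bij' (fun a _ => ⟨a.2, a.1.erase a.2⟩) (fun a _ => ⟨insert a.1 a.2, a.1⟩)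
    ?_ ?_ ?_ ?_ ?_
  · rintro ⟨S, x⟩ h
    simp only [mem_sigma, mem_powersetCard] at h ⊢
    refine ⟨h.1.1 h.2, erase_subset_erase _ h.1.1, ?_⟩
    rw [card_erase_of_mem h.2, h.1.2]; simp
  · rintro ⟨x, S⟩ h
    simp only [mem_sigma, mem_powersetCard] at h ⊢
    have hx : x ∉ S := fun hx => by simpa using h.2.1 hx
    refine ⟨⟨insert_subset h.1 (h.2.1.trans (erase_subset _ _)), ?_⟩, mem_insert_self _ _⟩
    rw [card_insert_of_notMem hx, h.2.2]
  · rintro ⟨S, x⟩ h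
    simp only [mem_sigma] at h
    simp [insert_erase h.2]
  · rintro ⟨x, S⟩ h
    simp only [mem_sigma, mem_powersetCard] at h
    have hx : x ∉ S := fun hx => by simpa using h.2.1 hx
    simp [erase_insert hx]
  · rintro ⟨S, x⟩ h
    simp only [mem_sigma] at h
    simp [insert_erase h.2]

theorem sum_sum_powersetCard_erase {V : Type*} [DecidableEq V] (A : Finset V) (m : ℕ) (G : Finset V → ℝ) :
    ∑ x ∈ A, ∑ S ∈ powersetCard m (A.erase x), G S =
      ((#A : ℝ) - m) * ∑ S ∈ powersetCard m A, G S := by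
  rw [Finset.sum_comm' (s' := fun S => A \ S) (t' := powersetCard m A), Finset.mul_sum]
  · refine Finset.sum_congr rfl fun S hS => ?_
    obtain ⟨h1, h2⟩ := mem_powersetCard.1 hS
    rw [Finset.sum_const, nsmul_eq_mul, cast_card_sdiff h1, h2]
  · intro x S
    simp only [mem_powersetCard, mem_sdiff, subset_erase]
    tauto

/-- The average of `g` over the `m`-element subsets of `A`. -/
def subsetAvg {V : Type*} (A : Finset V) (m : ℕ) (g : Finset V → ℝ) : ℝ :=
  (∑ S ∈ powersetCard m A, g S) / (#A).choose m

theorem subsetAvg_succ {V : Type*} [DecidableEq V] (A : Finset V) (m : ℕ) (hm : m < #A) (g : Finset V → ℝ) :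
    subsetAvg A (m + 1) g =
      (∑ x ∈ A, subsetAvg (A.erase x) m (fun S => g (insert x S))) / #A := by
  have hc : ∀ x ∈ A, subsetAvg (A.erase x) m (fun S => g (insert x S)) =
      (∑ S ∈ powersetCard m (A.erase x), g (insert x S)) / (#A - 1).choose m := fun x hx => by
    rw [subsetAvg, card_erase_of_mem hx]
  rw [Finset.sum_congr rfl hc, ← Finset.sum_div, ← succ_mul_sum_powersetCard_succ, subsetAvg]
  obtain ⟨k, hk⟩ : ∃ k, #A = k + 1 := ⟨#A - 1, by omega⟩
  rw [hk]
  have h1 : ((k + 1 : ℕ) : ℝ) * k.choose m = (k + 1).choose (m + 1) * ((m + 1 : ℕ) : ℝ) := by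
    exact_mod_cast Nat.add_one_mul_choose_eq k m
  have h2 : (0 : ℝ) < k.choose m := by exact_mod_cast Nat.choose_pos (by omega)
  have h3 : (0 : ℝ) < (k + 1).choose (m + 1) := by exact_mod_cast Nat.choose_pos (by omega)
  have h4 : (0 : ℝ) < ((k + 1 : ℕ) : ℝ) := by positivity
  rw [Nat.add_sub_cancel, div_div, div_eq_div_iff h3.ne' (mul_pos h2 h4).ne']
  rw [mul_comm ((k.choose m : ℝ)), h1]
  push_cast
  ring

theorem subsetAvg_mono {V : Type*} (A : Finset V) (m : ℕ) {g g' : Finset V → ℝ}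
    (h : ∀ S ∈ powersetCard m A, g S ≤ g' S) : subsetAvg A m g ≤ subsetAvg A m g' := by
  unfold subsetAvg
  gcongr with S hS
  exact h S hS

theorem subsetAvg_add_const {V : Type*} (A : Finset V) (m : ℕ) (hm : m ≤ #A) (g : Finset V → ℝ) (c : ℝ) :
    subsetAvg A m (fun S => g S + c) = subsetAvg A m g + c := by
  have h3 : (0 : ℝ) < (#A).choose m := by exact_mod_cast Nat.choose_pos hm
  unfold subsetAvg
  rw [Finset.sum_add_distrib, Finset.sum_const, card_powersetCard, add_div]
  congr 1
  rw [nsmul_eq_mul]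
  field_simp

/-- Conditioning on containing `x` and on containing `y` changes the mean by at most `c`, if
exchanging a single element changes `g` by at most `c`. -/
theorem subsetAvg_insert_sub_le {V : Type*} [DecidableEq V] (A : Finset V) (m : ℕ) (hm : m < #A) (g : Finset V → ℝ) (c : ℝ)
    (hg : ∀ S x y, g (insert x S) ≤ g (insert y S) + c)
    (hc : 0 ≤ c) {x y : V} (hx : x ∈ A) (hy : y ∈ A) :
    subsetAvg (A.erase x) m (fun S => g (insert x S)) ≤
      subsetAvg (A.erase y) m (fun S => g (insert y S)) + c := by
  have hmap : A.erase y = (A.erase x).map (Equiv.swap x y).toEmbedding := by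
    ext z
    simp only [mem_erase, mem_map_equiv, Equiv.symm_swap]
    rcases eq_or_ne z x with rfl | hzx
    · rcases eq_or_ne z y with rfl | hzy <;> simp_all [ne_comm]
    · rcases eq_or_ne z y with rfl | hzy
      · simp
      · simp [Equiv.swap_apply_of_ne_of_ne hzx hzy, hzx, hzy]
  have hcard : #(A.erase y) = #(A.erase x) := by rw [hmap, card_map]
  have hm' : m ≤ #(A.erase y) := by rw [card_erase_of_mem hy]; omega
  rw [← subsetAvg_add_const _ _ hm']
  have e : subsetAvg (A.erase y) m (fun S => g (insert y S) + c) =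
      subsetAvg (A.erase x) m
        (fun S => g (insert y (S.map (Equiv.swap x y).toEmbedding)) + c) := by
    unfold subsetAvg
    rw [hcard, hmap, powersetCard_map, sum_map]
    rfl
  rw [e]
  refine subsetAvg_mono _ _ fun S hS => ?_
  have hxS : x ∉ S := fun h => by simpa using (mem_powersetCard.1 hS).1 h
  by_cases hyS : y ∈ S
  · have : insert y (S.map (Equiv.swap x y).toEmbedding) = insert x S := by
      ext z
      simp only [mem_insert, mem_map_equiv, Equiv.symm_swap]
      rcases eq_or_ne z x with rfl | hzx
      · simp [hyS]
      · rcases eq_or_ne z y with rfl | hzy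
        · simp [hyS]
        · simp [Equiv.swap_apply_of_ne_of_ne hzx hzy, hzx, hzy]
    rw [this]; linarith
  · have : S.map (Equiv.swap x y).toEmbedding = S := by
      ext z
      simp only [mem_map_equiv, Equiv.symm_swap]
      rcases eq_or_ne z x with rfl | hzx
      · simp [hyS, hxS]
      · rcases eq_or_ne z y with rfl | hzy
        · simp [hyS, hxS]
        · simp [Equiv.swap_apply_of_ne_of_ne hzx hzy]
    rw [this]
    exact hg S x y

/-- Hoeffding's lemma for the uniform distribution on a finite set. -/
theorem sum_exp_le_of_sum_eq_zero {V : Type*} (A : Finset V) (X : V → ℝ) (c : ℝ)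
    (h0 : ∑ x ∈ A, X x = 0) (hX : ∀ x ∈ A, |X x| ≤ c) :
    ∑ x ∈ A, Real.exp (X x) ≤ #A * Real.exp (c ^ 2 / 2) := by
  rcases le_or_gt c 0 with hc | hc
  · have : ∀ x ∈ A, Real.exp (X x) ≤ Real.exp (c ^ 2 / 2) := fun x hx => by
      have := abs_le.1 (hX x hx)
      apply Real.exp_le_exp.2
      nlinarith [sq_nonneg c]
    calc _ ≤ ∑ x ∈ A, Real.exp (c ^ 2 / 2) := Finset.sum_le_sum this
      _ = _ := by simp
  · have : ∀ x ∈ A, Real.exp (X x) ≤ Real.cosh c + X x * (Real.sinh c / c) := fun x hx => by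
      obtain ⟨h1, h2⟩ := abs_le.1 (hX x hx)
      have hconv := (convexOn_exp).2 (Set.mem_univ (-c)) (Set.mem_univ c)
        (show 0 ≤ (c - X x) / (2 * c) from div_nonneg (by linarith) (by linarith))
        (show 0 ≤ (c + X x) / (2 * c) from div_nonneg (by linarith) (by linarith))
        (by field_simp; ring)
      have e : ((c - X x) / (2 * c)) • (-c) + ((c + X x) / (2 * c)) • c = X x := by
        simp only [smul_eq_mul]; field_simp; ring
      rw [e] at hconv
      refine hconv.trans (le_of_eq ?_)
      rw [Real.cosh_eq, Real.sinh_eq]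
      simp only [smul_eq_mul]
      field_simp
      ring
    calc _ ≤ ∑ x ∈ A, (Real.cosh c + X x * (Real.sinh c / c)) := Finset.sum_le_sum this
      _ = #A * Real.cosh c := by
        rw [Finset.sum_add_distrib, ← Finset.sum_mul, h0]; simp
      _ ≤ _ := by gcongr; exact Real.cosh_le_exp_half_sq c

/-- Sub-Gaussian moment generating function bound for sampling without replacement. -/
theorem subsetAvg_exp_le {V : Type*} [DecidableEq V] (m : ℕ) (c l : ℝ) (hc : 0 ≤ c) :
    ∀ (A : Finset V), m ≤ #A → ∀ g : Finset V → ℝ,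
    (∀ S x y, g (insert x S) ≤ g (insert y S) + c) →
    subsetAvg A m (fun S => Real.exp (l * (g S - subsetAvg A m g))) ≤
      Real.exp (m * ((l * c) ^ 2 / 2)) := by
  induction m with
  | zero => intro A _ g _; simp [subsetAvg]
  | succ m ih =>
    intro A hA g hg
    have hApos : (0 : ℝ) < #A := by exact_mod_cast (by omega : 0 < #A)
    set μ := subsetAvg A (m + 1) g with hμ
    set ν : V → ℝ := fun x => subsetAvg (A.erase x) m (fun S => g (insert x S)) with hν
    have hμν : μ = (∑ x ∈ A, ν x) / #A := subsetAvg_succ A m (by omega) g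
    have hdiff : ∀ x ∈ A, ∀ y ∈ A, ν x ≤ ν y + c := fun x hx y hy =>
      subsetAvg_insert_sub_le A m (by omega) g c hg hc hx hy
    have hdev : ∀ x ∈ A, |ν x - μ| ≤ c := fun x hx => by
      have h1 : ∑ y ∈ A, (ν x - c) ≤ ∑ y ∈ A, ν y :=
        Finset.sum_le_sum fun y hy => by linarith [hdiff x hx y hy]
      have h2 : ∑ y ∈ A, ν y ≤ ∑ y ∈ A, (ν x + c) :=
        Finset.sum_le_sum fun y hy => by linarith [hdiff y hy x hx]
      rw [Finset.sum_const, nsmul_eq_mul] at h1 h2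
      have h3 : ν x - c ≤ μ := by rw [hμν, le_div_iff₀ hApos]; linarith
      have h4 : μ ≤ ν x + c := by rw [hμν, div_le_iff₀ hApos]; linarith
      rw [abs_le]; constructor <;> linarith
    rw [subsetAvg_succ A m (by omega), div_le_iff₀ hApos]
    have hstep : ∀ x ∈ A,
        subsetAvg (A.erase x) m (fun S => Real.exp (l * (g (insert x S) - μ))) ≤
          Real.exp (m * ((l * c) ^ 2 / 2)) * Real.exp (l * (ν x - μ)) := fun x hx => by
      have hcard : m ≤ #(A.erase x) := by rw [card_erase_of_mem hx]; omega
      have hx' := ih (A.erase x) hcard (fun S => g (insert x S)) (fun S a b => by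
        rw [Finset.insert_comm x a, Finset.insert_comm x b]
        exact hg _ a b)
      calc _ = subsetAvg (A.erase x) m (fun S => Real.exp (l * (g (insert x S) - ν x))) *
            Real.exp (l * (ν x - μ)) := by
            unfold subsetAvg
            rw [div_mul_eq_mul_div, Finset.sum_mul]
            congr 1
            refine Finset.sum_congr rfl fun S _ => ?_
            rw [← Real.exp_add]; ring_nf
        _ ≤ _ := by gcongr
    have hcentered : ∑ x ∈ A, l * (ν x - μ) = 0 := by
      rw [← Finset.mul_sum, Finset.sum_sub_distrib, Finset.sum_const, nsmul_eq_mul, hμν,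
        mul_div_cancel₀ _ hApos.ne', sub_self, mul_zero]
    have hmgf := sum_exp_le_of_sum_eq_zero A (fun x => l * (ν x - μ)) (|l * c|) hcentered
      fun x hx => by
        rw [abs_mul, abs_mul]
        exact mul_le_mul_of_nonneg_left ((hdev x hx).trans (le_abs_self c)) (abs_nonneg l)
    rw [sq_abs] at hmgf
    calc _ ≤ ∑ x ∈ A, Real.exp (m * ((l * c) ^ 2 / 2)) * Real.exp (l * (ν x - μ)) :=
          Finset.sum_le_sum hstep
      _ ≤ Real.exp (m * ((l * c) ^ 2 / 2)) * (#A * Real.exp ((l * c) ^ 2 / 2)) := by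
          rw [← Finset.mul_sum]; gcongr
      _ = _ := by
          rw [mul_comm (#A : ℝ), ← mul_assoc, ← Real.exp_add]
          congr 2
          push_cast; ring

/-- One-sided bounded-differences inequality for sampling without replacement. -/
theorem card_filter_subsetAvg_lt_le {V : Type*} [DecidableEq V] (A : Finset V) (m : ℕ)
    (hm0 : 0 < m) (hm : m ≤ #A) (g : Finset V → ℝ) (c L : ℝ) (hc : 0 < c) (hL : 0 ≤ L)
    (hg : ∀ S x y, g (insert x S) ≤ g (insert y S) + c) :
    (#((powersetCard m A).filter
        (fun S => subsetAvg A m g + c * Real.sqrt (2 * m * L) < g S)) : ℝ) ≤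
      Real.exp (-L) * #(powersetCard m A) := by
  have hmR : (0 : ℝ) < m := by exact_mod_cast hm0
  set μ := subsetAvg A m g with hμ
  set r := Real.sqrt (2 * m * L) with hr
  have hr2 : r ^ 2 = 2 * m * L := Real.sq_sqrt (by positivity)
  have hr0 : 0 ≤ r := Real.sqrt_nonneg _
  set l := r / (m * c) with hl
  have hl0 : 0 ≤ l := by positivity
  have hexp : (m : ℝ) * ((l * c) ^ 2 / 2) = L := by
    have : (l * c) ^ 2 = r ^ 2 / m ^ 2 := by rw [hl]; field_simp
    rw [this, hr2]; field_simp
  have hmgf := subsetAvg_exp_le m c l hc.le A hm g hg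
  have hch : (0 : ℝ) < (#A).choose m := by exact_mod_cast Nat.choose_pos hm
  rw [hexp, subsetAvg, div_le_iff₀ hch] at hmgf
  have hmarkov : (#((powersetCard m A).filter (fun S => μ + c * r < g S)) : ℝ) *
      Real.exp (2 * L) ≤ ∑ S ∈ powersetCard m A, Real.exp (l * (g S - μ)) := by
    rw [← nsmul_eq_mul, ← Finset.sum_const]
    refine (Finset.sum_le_sum fun S hS => ?_).trans
      (Finset.sum_le_sum_of_subset_of_nonneg (filter_subset _ _)
        fun _ _ _ => (Real.exp_pos _).le)
    have h := (mem_filter.1 hS).2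
    apply Real.exp_le_exp.2
    have h1 : l * (c * r) = 2 * L := by
      have : l * (c * r) = r ^ 2 / m := by rw [hl]; field_simp
      rw [this, hr2]; field_simp
    rw [← h1]
    exact mul_le_mul_of_nonneg_left (by linarith) hl0
  rw [card_powersetCard]
  have h2 : Real.exp (2 * L) = Real.exp L * Real.exp L := by rw [← Real.exp_add]; ring_nf
  have h3 := hmarkov.trans hmgf
  rw [Real.exp_neg, inv_mul_eq_div, le_div_iff₀ (Real.exp_pos L)]
  have h4 := Real.exp_pos L
  rw [h2, ← mul_assoc, mul_comm (Real.exp L) (((#A).choose m : ℝ))] at h3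
  exact le_of_mul_le_mul_right h3 h4

/-- Averages over larger subsets are smaller for a function decreasing under insertion, and each
additional element costs at most `B`. -/
theorem subsetAvg_succ_le_and_le {V : Type*} [DecidableEq V] (A : Finset V) (g : Finset V → ℝ)
    (B : ℝ) (h1 : ∀ S x, g (insert x S) ≤ g S) (h2 : ∀ S x, g S ≤ g (insert x S) + B)
    (m : ℕ) (hm : m < #A) :
    subsetAvg A (m + 1) g ≤ subsetAvg A m g ∧ subsetAvg A m g ≤ subsetAvg A (m + 1) g + B := by
  have hApos : (0 : ℝ) < #A := by exact_mod_cast (by omega : 0 < #A)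
  have key : (∑ x ∈ A, subsetAvg (A.erase x) m g) / #A = subsetAvg A m g := by
    have hc : ∀ x ∈ A, subsetAvg (A.erase x) m g =
        (∑ S ∈ powersetCard m (A.erase x), g S) / (#A - 1).choose m := fun x hx => by
      rw [subsetAvg, card_erase_of_mem hx]
    rw [Finset.sum_congr rfl hc, ← Finset.sum_div, sum_sum_powersetCard_erase, subsetAvg]
    obtain ⟨k, hk⟩ : ∃ k, #A = k + 1 := ⟨#A - 1, by omega⟩
    have hmk : m ≤ k := by omega
    rw [hk, Nat.add_sub_cancel]
    have e : (k.choose m : ℝ) * ((k + 1 : ℕ) : ℝ) = (k + 1).choose m * (((k + 1 : ℕ) : ℝ) - m) := by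
      have := Nat.choose_mul_succ_eq k m
      rw [← Nat.cast_sub (by omega)]
      exact_mod_cast this
    have p1 : (0 : ℝ) < k.choose m := by exact_mod_cast Nat.choose_pos hmk
    have p2 : (0 : ℝ) < (k + 1).choose m := by exact_mod_cast Nat.choose_pos (by omega)
    have p3 : (0 : ℝ) < ((k + 1 : ℕ) : ℝ) := by positivity
    rw [div_div, div_eq_div_iff (mul_pos p1 p3).ne' p2.ne', e]
    ring
  have hcard : ∀ x ∈ A, m ≤ #(A.erase x) := fun x hx => by rw [card_erase_of_mem hx]; omega
  rw [subsetAvg_succ A m hm, ← key]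
  constructor
  · gcongr with x hx
    exact subsetAvg_mono _ _ fun S _ => h1 S x
  · rw [div_add' _ _ _ hApos.ne']
    gcongr
    calc _ ≤ ∑ x ∈ A, (subsetAvg (A.erase x) m (fun S => g (insert x S)) + B) :=
          Finset.sum_le_sum fun x hx => by
            rw [← subsetAvg_add_const _ _ (hcard x hx)]
            exact subsetAvg_mono _ _ fun S _ => h2 S x
      _ = _ := by rw [Finset.sum_add_distrib, Finset.sum_const, nsmul_eq_mul, mul_comm B]

theorem subsetAvg_le_add_abs {V : Type*} [DecidableEq V] (A : Finset V) (g : Finset V → ℝ)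
    (B : ℝ) (hB : 0 ≤ B) (h1 : ∀ S x, g (insert x S) ≤ g S)
    (h2 : ∀ S x, g S ≤ g (insert x S) + B) (m s : ℕ) (hm : m ≤ #A) (hs : s ≤ #A) :
    subsetAvg A m g ≤ subsetAvg A s g + B * |(m : ℝ) - s| := by
  rcases le_total s m with h | h
  · have : subsetAvg A m g ≤ subsetAvg A s g := by
      induction m, h using Nat.le_induction with
      | base => rfl
      | succ k hk ih =>
        exact (subsetAvg_succ_le_and_le A g B h1 h2 k (by omega)).1.trans (ih (by omega))
    have := mul_nonneg hB (abs_nonneg ((m : ℝ) - s))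
    linarith
  · have hms : (m : ℝ) ≤ s := by exact_mod_cast h
    rw [abs_sub_comm, abs_of_nonneg (by linarith)]
    induction s, h using Nat.le_induction with
    | base => simp
    | succ k hk ih =>
      have a := (subsetAvg_succ_le_and_le A g B h1 h2 k (by omega)).2
      have b := ih (by omega) (by exact_mod_cast hk)
      push_cast
      linarith

/-- The weight of `S` when each element of an `N`-element set is selected independently with
probability `p`. -/
def bernoulliWeight {V : Type*} (p : ℝ) (N : ℕ) (S : Finset V) : ℝ :=
  p ^ #S * (1 - p) ^ (N - #S)

/-- Sampling a fixed number of elements is comparable with independent sampling. -/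
theorem subsetAvg_le_bernoulli {V : Type*} [DecidableEq V] (A : Finset V) (g : Finset V → ℝ)
    (B : ℝ) (hB : 0 ≤ B) (h1 : ∀ S x, g (insert x S) ≤ g S)
    (h2 : ∀ S x, g S ≤ g (insert x S) + B) (m : ℕ) (hm0 : 0 < m) (hm : m ≤ #A) (p : ℝ)
    (hp : p * #A = m) :
    subsetAvg A m g ≤ ∑ S ∈ A.powerset, bernoulliWeight p #A S * g S + B * Real.sqrt m := by
  set N := #A with hN
  have hmR : (0 : ℝ) < m := by exact_mod_cast hm0
  have hNR : (0 : ℝ) < N := by exact_mod_cast (by omega : 0 < N)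
  have hmN : (m : ℝ) ≤ N := by exact_mod_cast hm
  have hp' : p = m / N := by rw [← hp]; field_simp
  have hp0 : 0 ≤ p := by rw [hp']; positivity
  have hp1 : p ≤ 1 := by rw [hp', div_le_one hNR]; exact hmN
  set b : ℕ → ℝ := fun s => (N.choose s : ℝ) * p ^ s * (1 - p) ^ (N - s) with hb
  have hb0 : ∀ s, 0 ≤ b s := fun s => by
    have : 0 ≤ 1 - p := by linarith
    positivity
  have hbern : ∀ s, (bernsteinPolynomial ℝ N s).eval p = b s := fun s => by
    simp [bernsteinPolynomial, hb]
  have hsum : ∑ s ∈ range (N + 1), b s = 1 := by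
    have := congrArg (Polynomial.eval p) (bernsteinPolynomial.sum ℝ N)
    simpa [Polynomial.eval_finsetSum, hbern] using this
  have hvar : ∑ s ∈ range (N + 1), ((m : ℝ) - s) ^ 2 * b s = m * (1 - p) := by
    have := congrArg (Polynomial.eval p) (bernsteinPolynomial.variance ℝ N)
    simp only [Polynomial.eval_finsetSum, Polynomial.eval_mul, Polynomial.eval_pow,
      Polynomial.eval_sub, Polynomial.eval_X, Polynomial.eval_natCast,
      Polynomial.eval_one, hbern, nsmul_eq_mul] at this
    rw [mul_comm (N : ℝ) p, hp] at this
    exact this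
  have hsplit : ∑ S ∈ A.powerset, bernoulliWeight p N S * g S =
      ∑ s ∈ range (N + 1), b s * subsetAvg A s g := by
    rw [Finset.sum_powerset]
    refine Finset.sum_congr rfl fun s hs => ?_
    have hs' : s ≤ N := by simpa [Nat.lt_succ_iff] using hs
    have hch : (0 : ℝ) < N.choose s := by exact_mod_cast Nat.choose_pos hs'
    rw [subsetAvg, ← hN, hb]
    have : ∀ S ∈ powersetCard s A, bernoulliWeight p N S * g S = p ^ s * (1 - p) ^ (N - s) * g S :=
      fun S hS => by rw [bernoulliWeight, (mem_powersetCard.1 hS).2]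
    rw [Finset.sum_congr rfl this, ← Finset.mul_sum]
    field_simp
  set r := Real.sqrt m with hr
  have hr0 : 0 < r := Real.sqrt_pos.2 hmR
  have hr2 : r ^ 2 = m := Real.sq_sqrt hmR.le
  have hdev : ∀ s : ℕ, |(m : ℝ) - s| ≤ (((m : ℝ) - s) ^ 2 / r + r) / 2 := fun s => by
    rw [le_div_iff₀ (by norm_num), div_add' _ _ _ hr0.ne', le_div_iff₀ hr0, ← sq_abs]
    nlinarith [sq_nonneg (|(m : ℝ) - s| - r)]
  calc subsetAvg A m g = ∑ s ∈ range (N + 1), b s * subsetAvg A m g := by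
        rw [← Finset.sum_mul, hsum, one_mul]
    _ ≤ ∑ s ∈ range (N + 1),
        (b s * subsetAvg A s g + B * ((((m : ℝ) - s) ^ 2 * b s) / (2 * r) + b s * (r / 2))) := by
        refine Finset.sum_le_sum fun s hs => ?_
        have hs' : s ≤ N := by simpa [Nat.lt_succ_iff] using hs
        have a := subsetAvg_le_add_abs A g B hB h1 h2 m s hm hs'
        have a' := mul_le_mul_of_nonneg_left (hdev s) hB
        have a'' := mul_le_mul_of_nonneg_left (a.trans (by gcongr)) (hb0 s)
        refine a''.trans ((mul_le_mul_of_nonneg_left (add_le_add_right a' _) (hb0 s)).trans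
          (le_of_eq ?_))
        field_simp
    _ = ∑ S ∈ A.powerset, bernoulliWeight p N S * g S +
        B * (m * (1 - p) / (2 * r) + r / 2) := by
        rw [Finset.sum_add_distrib, ← Finset.mul_sum, Finset.sum_add_distrib, ← Finset.sum_div,
          hvar, ← Finset.sum_mul, hsum, one_mul, hsplit]
    _ ≤ _ := by
        gcongr
        have : (m : ℝ) * (1 - p) / (2 * r) ≤ r / 2 := by
          rw [div_le_div_iff₀ (by positivity) (by norm_num)]
          nlinarith
        linarith

/-- Uniform boundedness of a real function. -/
def UniformlyBounded {T : Type*} (A : T → ℝ) : Prop := ∃ M, ∀ t, |A t| ≤ M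

namespace UniformlyBounded

variable {T : Type*} {A A' : T → ℝ}

theorem add (hA : UniformlyBounded A) (hA' : UniformlyBounded A') :
    UniformlyBounded (fun t => A t + A' t) := by
  obtain ⟨M, hM⟩ := hA
  obtain ⟨M', hM'⟩ := hA'
  exact ⟨M + M', fun t => (abs_add_le _ _).trans (add_le_add (hM t) (hM' t))⟩

theorem const_mul (c : ℝ) (hA : UniformlyBounded A) : UniformlyBounded (fun t => c * A t) := by
  obtain ⟨M, hM⟩ := hA
  exact ⟨|c| * M, fun t => by
    rw [abs_mul]; exact mul_le_mul_of_nonneg_left (hM t) (abs_nonneg c)⟩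

theorem sub (hA : UniformlyBounded A) (hA' : UniformlyBounded A') :
    UniformlyBounded (fun t => A t - A' t) := by
  simpa [sub_eq_add_neg] using hA.add (hA'.const_mul (-1))

theorem sum {V : Type*} {h : V → T → ℝ} (hh : ∀ k, UniformlyBounded (h k)) (U : Finset V) :
    UniformlyBounded (fun t => ∑ k ∈ U, h k t) := by
  choose M hM using hh
  exact ⟨∑ k ∈ U, M k, fun t =>
    (Finset.abs_sum_le_sum_abs _ _).trans (Finset.sum_le_sum fun k _ => hM k t)⟩

theorem bddAbove (hA : UniformlyBounded A) : BddAbove (Set.range A) := by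
  obtain ⟨M, hM⟩ := hA
  exact ⟨M, by rintro _ ⟨t, rfl⟩; exact (le_abs_self _).trans (hM t)⟩

theorem le_ciSup (hA : UniformlyBounded A) (t : T) : A t ≤ ⨆ t, A t :=
  _root_.le_ciSup hA.bddAbove t

end UniformlyBounded

/-- One-coordinate contraction principle. -/
theorem iSup_add_add_iSup_sub_le {T : Type*} [Nonempty T] {A h F : T → ℝ}
    (hA : UniformlyBounded A) (hF : UniformlyBounded F)
    (hhF : ∀ s t, |h s - h t| ≤ |F s - F t|) :
    (⨆ t, (A t + h t)) + (⨆ t, (A t - h t)) ≤ (⨆ t, (A t + F t)) + (⨆ t, (A t - F t)) := by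
  rw [← le_sub_iff_add_le]
  refine ciSup_le fun s => ?_
  rw [le_sub_iff_add_le, ← le_sub_iff_add_le']
  refine ciSup_le fun t => ?_
  have h1 := (hA.add hF).le_ciSup
  have h2 := (hA.sub hF).le_ciSup
  have h3 := (le_abs_self _).trans (hhF s t)
  have a1 := h1 s
  have a2 := h1 t
  have b1 := h2 s
  have b2 := h2 t
  rcases abs_cases (F s - F t) with ⟨h4, -⟩ | ⟨h4, -⟩ <;> rw [h4] at h3 <;> linarith

/-- Replacing a centred two-point variable by a symmetric one, and `h` by the contraction-dominating
function `F`, does not decrease the expected supremum. -/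
theorem two_point_iSup_le {T : Type*} [Nonempty T] {A h F : T → ℝ}
    (hA : UniformlyBounded A) (hh : UniformlyBounded h) (hF : UniformlyBounded F)
    (hhF : ∀ s t, |h s - h t| ≤ |F s - F t|) {p : ℝ} (hp0 : 0 ≤ p) (hp1 : p ≤ 1) :
    p * (⨆ t, (A t + (p - 1) * h t)) + (1 - p) * (⨆ t, (A t + p * h t)) ≤
      p * (1 - p) * (⨆ t, (A t + F t)) + p * (1 - p) * (⨆ t, (A t - F t)) +
        (1 - 2 * (p * (1 - p))) * ⨆ t, A t := by
  have hq : 0 ≤ 1 - p := by linarith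
  have e1 : (⨆ t, (A t + (p - 1) * h t)) ≤ p * (⨆ t, A t) + (1 - p) * ⨆ t, (A t - h t) := by
    refine ciSup_le fun t => ?_
    have a := mul_le_mul_of_nonneg_left (hA.le_ciSup t) hp0
    have b := mul_le_mul_of_nonneg_left ((hA.sub hh).le_ciSup t) hq
    nlinarith
  have e2 : (⨆ t, (A t + p * h t)) ≤ p * (⨆ t, (A t + h t)) + (1 - p) * ⨆ t, A t := by
    refine ciSup_le fun t => ?_
    have a := mul_le_mul_of_nonneg_left (hA.le_ciSup t) hq
    have b := mul_le_mul_of_nonneg_left ((hA.add hh).le_ciSup t) hp0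
    nlinarith
  have e3 := mul_le_mul_of_nonneg_left (iSup_add_add_iSup_sub_le hA hF hhF)
    (mul_nonneg hp0 hq)
  have e1' := mul_le_mul_of_nonneg_left e1 hp0
  have e2' := mul_le_mul_of_nonneg_left e2 hq
  nlinarith

/-- Expected supremum of `A + ∑ σ_k F_k` over `k` in a list, for independent `σ_k` equal to `1` and
`-1` with probability `q` each, and to `0` otherwise. -/
def signedSup {V T : Type*} (q : ℝ) (F : V → T → ℝ) : List V → (T → ℝ) → ℝ
  | [], A => ⨆ t, A t
  | k :: l, A => q * signedSup q F l (fun t => A t + F k t) +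
      q * signedSup q F l (fun t => A t - F k t) + (1 - 2 * q) * signedSup q F l A

theorem two_point_signedSup_le {V T : Type*} [Nonempty T] {F : V → T → ℝ}
    (hFb : ∀ k, UniformlyBounded (F k)) {p : ℝ} (hp0 : 0 ≤ p) (hp1 : p ≤ 1)
    {h G : T → ℝ} (hh : UniformlyBounded h) (hG : UniformlyBounded G)
    (hhG : ∀ s t, |h s - h t| ≤ |G s - G t|) (l : List V) :
    ∀ A : T → ℝ, UniformlyBounded A →
    p * signedSup (p * (1 - p)) F l (fun t => A t + (p - 1) * h t) +
        (1 - p) * signedSup (p * (1 - p)) F l (fun t => A t + p * h t) ≤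
      p * (1 - p) * signedSup (p * (1 - p)) F l (fun t => A t + G t) +
        p * (1 - p) * signedSup (p * (1 - p)) F l (fun t => A t - G t) +
        (1 - 2 * (p * (1 - p))) * signedSup (p * (1 - p)) F l A := by
  have hq0 : 0 ≤ p * (1 - p) := mul_nonneg hp0 (by linarith)
  have hq1 : 0 ≤ 1 - 2 * (p * (1 - p)) := by nlinarith [sq_nonneg (2 * p - 1)]
  induction l with
  | nil => intro A hA; exact two_point_iSup_le hA hh hG hhG hp0 hp1
  | cons k l ih =>
    intro A hA
    have i1 := mul_le_mul_of_nonneg_left (ih _ (hA.add (hFb k))) hq0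
    have i2 := mul_le_mul_of_nonneg_left (ih _ (hA.sub (hFb k))) hq0
    have i3 := mul_le_mul_of_nonneg_left (ih _ hA) hq1
    have c1 : ∀ X Y : T → ℝ, (fun t => A t + X t + Y t) = fun t => A t + Y t + X t :=
      fun X Y => by funext t; ring
    have c2 : ∀ X Y : T → ℝ, (fun t => A t - X t + Y t) = fun t => A t + Y t - X t :=
      fun X Y => by funext t; ring
    have c3 : (fun t => A t - F k t - G t) = fun t => A t - G t - F k t := by funext t; ring
    rw [c1 (F k) (fun t => (p - 1) * h t), c1 (F k) (fun t => p * h t), c1 (F k) G,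
      ← c2 G (F k)] at i1
    rw [c2 (F k) (fun t => (p - 1) * h t), c2 (F k) (fun t => p * h t), c2 (F k) G, c3] at i2
    simp only [signedSup]
    linarith

/-- Symmetrization and contraction for independent sampling. -/
theorem sum_bernoulliWeight_mul_iSup_le {V T : Type*} [DecidableEq V] [Nonempty T]
    {h F : V → T → ℝ} (hh : ∀ k, UniformlyBounded (h k)) (hF : ∀ k, UniformlyBounded (F k))
    (hhF : ∀ k s t, |h k s - h k t| ≤ |F k s - F k t|) {p : ℝ} (hp0 : 0 ≤ p) (hp1 : p ≤ 1)
    (l : List V) (hl : l.Nodup) :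
    ∀ A : T → ℝ, UniformlyBounded A →
    ∑ S ∈ l.toFinset.powerset, bernoulliWeight p l.length S *
        (⨆ t, (A t + (p * ∑ k ∈ l.toFinset, h k t - ∑ k ∈ S, h k t))) ≤
      signedSup (p * (1 - p)) F l A := by
  induction l with
  | nil => intro A _; simp [signedSup, bernoulliWeight]
  | cons k l ih =>
    intro A hA
    obtain ⟨hk, hl'⟩ := List.nodup_cons.1 hl
    have hk' : k ∉ l.toFinset := by simpa using hk
    rw [List.toFinset_cons, Finset.sum_powerset_insert hk', signedSup]
    refine le_trans ?_ (two_point_signedSup_le hF hp0 hp1 (hh k) (hF k) (hhF k) l A hA)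
    have i1 := mul_le_mul_of_nonneg_left (ih hl' _ (hA.add ((hh k).const_mul (p - 1)))) hp0
    have i2 := mul_le_mul_of_nonneg_left (ih hl' _ (hA.add ((hh k).const_mul p)))
      (sub_nonneg.2 hp1)
    rw [add_comm]
    refine le_trans (le_of_eq ?_) (add_le_add i1 i2)
    rw [Finset.mul_sum, Finset.mul_sum]
    have hS : ∀ S ∈ l.toFinset.powerset, k ∉ S ∧ #S ≤ l.length := fun S hS =>
      ⟨fun h => hk' (mem_powerset.1 hS h),
        (card_le_card (mem_powerset.1 hS)).trans l.toFinset_card_le⟩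
    congr 1
    · refine Finset.sum_congr rfl fun S hSl => ?_
      obtain ⟨h1, -⟩ := hS S hSl
      rw [← mul_assoc]
      congr 1
      · rw [bernoulliWeight, bernoulliWeight, card_insert_of_notMem h1, List.length_cons,
          Nat.add_sub_add_right]
        ring
      · refine iSup_congr fun t => ?_
        rw [Finset.sum_insert hk', Finset.sum_insert h1]
        ring
    · refine Finset.sum_congr rfl fun S hSl => ?_
      obtain ⟨-, h2⟩ := hS S hSl
      rw [← mul_assoc]
      congr 1
      · rw [bernoulliWeight, bernoulliWeight, List.length_cons, Nat.sub_add_comm h2]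
        ring
      · refine iSup_congr fun t => ?_
        rw [Finset.sum_insert hk']
        ring

/-- A bound on the Rademacher-type average of the linear functionals given by the rows of `M` over
the cube of radius `C`. -/
theorem signedSup_linear_le {V W : Type*} [Fintype W] (M : V → W → ℝ) {C q s : ℝ} (hC : 0 ≤ C)
    (hq0 : 0 ≤ q) (hq1 : 2 * q ≤ 1) (hs : 0 < s) (l : List V) :
    ∀ v : W → ℝ,
    signedSup q (fun k (β : {β : W → ℝ // ∀ j, |β j| ≤ C}) => ∑ j, M k j * β.1 j) l
        (fun β => ∑ j, v j * β.1 j) ≤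
      C / 2 * (Fintype.card W * s +
        (∑ j, v j ^ 2 + 2 * q * (l.map fun k => ∑ j, M k j ^ 2).sum) / s) := by
  have : Nonempty {β : W → ℝ // ∀ j, |β j| ≤ C} := ⟨⟨0, fun j => by simpa using hC⟩⟩
  induction l with
  | nil =>
    intro v
    refine ciSup_le fun β => ?_
    have : ∀ j, v j * β.1 j ≤ C / 2 * (s + v j ^ 2 / s) := fun j => by
      have h1 : v j * β.1 j ≤ |v j| * C := (le_abs_self _).trans (by
        rw [abs_mul]; exact mul_le_mul_of_nonneg_left (β.2 j) (abs_nonneg _))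
      have h2 : |v j| ≤ (s + v j ^ 2 / s) / 2 := by
        rw [le_div_iff₀ (by norm_num), add_div' _ _ _ hs.ne', le_div_iff₀ hs, ← sq_abs]
        nlinarith [sq_nonneg (|v j| - s)]
      nlinarith
    refine (Finset.sum_le_sum fun j _ => this j).trans (le_of_eq ?_)
    rw [← Finset.mul_sum, Finset.sum_add_distrib, ← Finset.sum_div]
    simp
  | cons k l ih =>
    intro v
    have i1 := mul_le_mul_of_nonneg_left (ih (fun j => v j + M k j)) hq0
    have i2 := mul_le_mul_of_nonneg_left (ih (fun j => v j - M k j)) hq0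
    have i3 := mul_le_mul_of_nonneg_left (ih v) (by linarith : 0 ≤ 1 - 2 * q)
    simp only [add_mul, sub_mul, Finset.sum_add_distrib, Finset.sum_sub_distrib] at i1 i2
    rw [signedSup]
    refine (add_le_add (add_le_add i1 i2) i3).trans (le_of_eq ?_)
    simp only [add_sq, sub_sq, Finset.sum_add_distrib, Finset.sum_sub_distrib, List.map_cons,
      List.sum_cons]
    field_simp
    ring

theorem lam1_nonneg {ι : Type*} [Fintype ι] [DecidableEq ι] {K : Matrix ι ι ℝ}
    (hK : K.PosSemidef) : 0 ≤ lam1 K := by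
  rw [lam1, dif_pos hK.isHermitian]
  exact Real.iSup_nonneg fun i => hK.eigenvalues_nonneg i

/-- The squared norm of a row of a positive semidefinite matrix is at most the largest eigenvalue
times the diagonal entry. -/
theorem sum_sq_row_le {ι : Type*} [Fintype ι] [DecidableEq ι] {K : Matrix ι ι ℝ}
    (hK : K.PosSemidef) (i : ι) : ∑ j, K i j ^ 2 ≤ lam1 K * K i i := by
  have hH := hK.isHermitian
  set d := hH.eigenvalues with hd
  set U : Matrix ι ι ℝ := (hH.eigenvectorUnitary : Matrix ι ι ℝ) with hU
  have hUU : star U * U = 1 := Unitary.coe_star_mul_self hH.eigenvectorUnitary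
  have hspec : K = U * diagonal d * star U := by
    have := hH.spectral_theorem
    rw [Unitary.conjStarAlgAut_apply] at this
    exact this
  have hdle : ∀ a, d a ≤ lam1 K := fun a => by
    rw [lam1, dif_pos hH]
    exact le_ciSup (f := hH.eigenvalues) (Set.finite_range _).bddAbove a
  have hdiag : K i i = ∑ a, d a * U i a ^ 2 := by
    conv_lhs => rw [hspec]
    rw [Matrix.mul_apply]
    refine Finset.sum_congr rfl fun a _ => ?_
    rw [Matrix.mul_diagonal, Matrix.star_apply, star_trivial]
    ring
  have hsq : ∑ j, K i j ^ 2 = ∑ a, d a ^ 2 * U i a ^ 2 := by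
    have h1 : ∑ j, K i j ^ 2 = (K * K) i i := by
      rw [Matrix.mul_apply]
      refine Finset.sum_congr rfl fun j _ => ?_
      have : K j i = K i j := by simpa using hH.apply i j
      rw [this, sq]
    have h2 : K * K = U * diagonal (fun a => d a * d a) * star U := by
      conv_lhs => rw [hspec]
      calc _ = U * diagonal d * (star U * U) * diagonal d * star U := by
            simp only [Matrix.mul_assoc]
        _ = _ := by rw [hUU, Matrix.mul_one, Matrix.mul_assoc U, Matrix.diagonal_mul_diagonal]
    rw [h1, h2, Matrix.mul_apply]
    refine Finset.sum_congr rfl fun a _ => ?_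
    rw [Matrix.mul_diagonal, Matrix.star_apply, star_trivial]
    ring
  rw [hsq, hdiag, Finset.mul_sum]
  refine Finset.sum_le_sum fun a _ => ?_
  rw [← mul_assoc, sq (d a)]
  gcongr
  · exact hK.eigenvalues_nonneg a
  · exact hdle a

theorem sum_sq_row_kronecker_le {n : ℕ} {G : SimpleGraph (Fin n)} {K : Matrix (Fin n) (Fin n) ℝ}
    (hK : K ∈ gramSet G) (k : Pairs n) :
    ∑ l : Pairs n, ((K ⊗ₖ K) k.val l.val) ^ 2 ≤ lam1 K ^ 2 := by
  obtain ⟨hpsd, hdiag, -⟩ := hK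
  have hrow : ∀ i, ∑ j, K i j ^ 2 ≤ lam1 K := fun i => by
    simpa [hdiag i] using sum_sq_row_le hpsd i
  calc ∑ l : Pairs n, ((K ⊗ₖ K) k.val l.val) ^ 2
      ≤ ∑ l : Fin n × Fin n, ((K ⊗ₖ K) k.val l) ^ 2 := by
        rw [← Finset.sum_subtype (univ.filter fun q : Fin n × Fin n => q.1 < q.2) (by simp)
          (fun l => ((K ⊗ₖ K) k.val l) ^ 2)]
        exact Finset.sum_le_sum_of_subset_of_nonneg (filter_subset _ _)
          fun _ _ _ => sq_nonneg _
    _ = (∑ i, K k.val.1 i ^ 2) * ∑ j, K k.val.2 j ^ 2 := by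
        rw [Fintype.sum_prod_type, Finset.sum_mul_sum]
        simp [kroneckerMap_apply, mul_pow]
    _ ≤ lam1 K * lam1 K :=
        mul_le_mul (hrow _) (hrow _) (Finset.sum_nonneg fun _ _ => sq_nonneg _) (lam1_nonneg hpsd)
    _ = lam1 K ^ 2 := (sq _).symm

/-- Uniform deviation bound, with high probability over a uniformly random `m`-subset `S`, for the
losses of the linear class `{M β : ‖β‖_∞ ≤ C}`. -/
theorem card_filter_uniform_deviation_ge {V : Type*} [Fintype V] [DecidableEq V] (M : V → V → ℝ)
    {Λ C ρ B L : ℝ} (hΛ : 0 < Λ) (hM : ∀ k, ∑ j, M k j ^ 2 ≤ Λ ^ 2) (hC : 0 < C) (hρ : 0 < ρ)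
    (hB : 0 < B) (hL : 0 ≤ L) (h : V → ℝ → ℝ) (hh : ∀ k t, h k t ∈ Set.Icc 0 B)
    (hlip : ∀ k s t, |h k s - h k t| ≤ (1 / ρ) * |s - t|) {m : ℕ} (hm0 : 0 < m)
    (hm : m < Fintype.card V) {p : ℝ} (hp : p * Fintype.card V = m) :
    (1 - Real.exp (-L)) * (#(powersetCard m (univ : Finset V)) : ℝ) ≤
    (#((powersetCard m (univ : Finset V)).filter fun S =>
      ∀ β : V → ℝ, (∀ k, |β k| ≤ C) →
        p * ∑ k, h k (∑ j, M k j * β j) - ∑ k ∈ S, h k (∑ j, M k j * β j) ≤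
          C * Λ / ρ * Fintype.card V * Real.sqrt (2 * (p * (1 - p))) + B * Real.sqrt m +
            B * Real.sqrt (2 * m * L)) : ℝ) := by
  set N := Fintype.card V with hN
  have hmR : (0 : ℝ) < m := by exact_mod_cast hm0
  have hmN : (m : ℝ) < N := by exact_mod_cast hm
  have hNR : (0 : ℝ) < N := hmR.trans hmN
  have hp' : p = m / N := by rw [← hp]; field_simp
  have hp0 : 0 < p := by rw [hp']; positivity
  have hp1 : p < 1 := by rw [hp', div_lt_one hNR]; exact hmN
  have hq0 : 0 < p * (1 - p) := mul_pos hp0 (by linarith)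
  have hq1 : 2 * (p * (1 - p)) ≤ 1 := by nlinarith [sq_nonneg (2 * p - 1)]
  let T := {β : V → ℝ // ∀ j, |β j| ≤ C}
  have hT : Nonempty T := ⟨⟨0, fun j => by simpa using hC.le⟩⟩
  let F : V → T → ℝ := fun k β => ∑ j, M k j * β.1 j
  let H : V → T → ℝ := fun k β => h k (F k β)
  let F' : V → T → ℝ := fun k β => ∑ j, (M k j / ρ) * β.1 j
  have hF' : ∀ k β, F' k β = (1 / ρ) * F k β := fun k β => by
    simp only [F', F, Finset.mul_sum]
    exact Finset.sum_congr rfl fun j _ => by ring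
  have hFb : ∀ k, UniformlyBounded (F' k) := fun k =>
    UniformlyBounded.sum (h := fun j (β : T) => (M k j / ρ) * β.1 j)
      (fun j => UniformlyBounded.const_mul _ ⟨C, fun β => β.2 j⟩) univ
  have hHb : ∀ k, UniformlyBounded (H k) := fun k => ⟨B, fun β => by
    have := hh k (F k β)
    rw [abs_of_nonneg this.1]; exact this.2⟩
  have hHF : ∀ k s t, |H k s - H k t| ≤ |F' k s - F' k t| := fun k s t => by
    refine (hlip k _ _).trans (le_of_eq ?_)
    rw [hF', hF', ← mul_sub, abs_mul, abs_of_pos (show 0 < 1 / ρ by positivity)]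
  have hDb : ∀ S : Finset V, UniformlyBounded (fun β => p * ∑ k, H k β - ∑ k ∈ S, H k β) :=
    fun S => ((UniformlyBounded.sum hHb univ).const_mul p).sub (UniformlyBounded.sum hHb S)
  let g : Finset V → ℝ := fun S => ⨆ β, (p * ∑ k, H k β - ∑ k ∈ S, H k β)
  have hins : ∀ (S : Finset V) x β, ∑ k ∈ S, H k β ≤ ∑ k ∈ insert x S, H k β ∧
      ∑ k ∈ insert x S, H k β ≤ ∑ k ∈ S, H k β + B := fun S x β => by
    have := hh x (F x β)
    by_cases hx : x ∈ S
    · rw [insert_eq_of_mem hx]; constructor <;> linarith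
    · rw [Finset.sum_insert hx]
      constructor <;> linarith [this.1, this.2, show H x β = h x (F x β) from rfl]
  have hg1 : ∀ S x, g (insert x S) ≤ g S := fun S x => ciSup_le fun β =>
    le_trans (by linarith [(hins S x β).1]) ((hDb S).le_ciSup β)
  have hg2 : ∀ S x, g S ≤ g (insert x S) + B := fun S x => ciSup_le fun β => by
    have a := (hDb (insert x S)).le_ciSup β
    have b := (hins S x β).2
    change _ ≤ g (insert x S) at a
    linarith
  have hnodup : (univ : Finset V).toList.Nodup := Finset.nodup_toList _
  have hlen : (univ : Finset V).toList.length = N := by rw [length_toList, card_univ]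
  have hmean : subsetAvg univ m g ≤
      C * Λ / ρ * N * Real.sqrt (2 * (p * (1 - p))) + B * Real.sqrt m := by
    refine (subsetAvg_le_bernoulli univ g B hB.le hg1 hg2 m hm0 hm.le p hp).trans ?_
    gcongr
    have hsym := sum_bernoulliWeight_mul_iSup_le hHb hFb hHF hp0.le hp1.le _ hnodup
      (fun _ => 0) ⟨0, fun _ => by simp⟩
    rw [hlen, toList_toFinset] at hsym
    simp only [zero_add] at hsym
    set s := Λ / ρ * Real.sqrt (2 * (p * (1 - p))) with hs
    have hs0 : 0 < s := mul_pos (by positivity) (Real.sqrt_pos.2 (by positivity))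
    have hlin := signedSup_linear_le (fun k j => M k j / ρ) hC.le hq0.le hq1 hs0
      (univ : Finset V).toList (fun _ => 0)
    simp only [zero_mul, Finset.sum_const_zero] at hlin
    refine hsym.trans (hlin.trans ?_)
    have hsum : ((univ : Finset V).toList.map fun k => ∑ j, (M k j / ρ) ^ 2).sum ≤
        N * (Λ ^ 2 / ρ ^ 2) := by
      rw [Finset.sum_map_toList]
      refine (Finset.sum_le_sum (g := fun _ => Λ ^ 2 / ρ ^ 2) fun k _ => ?_).trans (by simp [hN])
      simp only [div_pow]
      rw [← Finset.sum_div]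
      gcongr
      exact hM k
    have hs2 : s ^ 2 = Λ ^ 2 / ρ ^ 2 * (2 * (p * (1 - p))) := by
      rw [hs, mul_pow, Real.sq_sqrt (by positivity), div_pow]
    calc _ ≤ C / 2 * (N * s + (0 + 2 * (p * (1 - p)) * (N * (Λ ^ 2 / ρ ^ 2))) / s) := by
          rw [show (∑ _j : V, (0 : ℝ) ^ 2) = 0 by simp]
          gcongr
      _ = C / 2 * (N * s + N * s ^ 2 / s) := by rw [hs2]; ring
      _ = C * N * s := by field_simp; ring
      _ = _ := by rw [hs]; ring
  have htail := card_filter_subsetAvg_lt_le univ m hm0 hm.le g B L hB hL fun S x y =>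
    (hg1 S x).trans (hg2 S y)
  have hsplit := card_filter_add_card_filter_not (s := powersetCard m (univ : Finset V))
    (fun S => subsetAvg univ m g + B * Real.sqrt (2 * m * L) < g S)
  have hsplit' : (#((powersetCard m (univ : Finset V)).filter
        fun S => subsetAvg univ m g + B * Real.sqrt (2 * m * L) < g S) : ℝ) +
      #((powersetCard m (univ : Finset V)).filter
        fun S => ¬ (subsetAvg univ m g + B * Real.sqrt (2 * m * L) < g S)) =
      #(powersetCard m (univ : Finset V)) := by exact_mod_cast hsplit
  have hsub : (#((powersetCard m (univ : Finset V)).filter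
      fun S => ¬ (subsetAvg univ m g + B * Real.sqrt (2 * m * L) < g S)) : ℝ) ≤ _ :=
    Nat.cast_le.2 (card_le_card (Finset.monotone_filter_right _
      (q := fun S => ∀ β : V → ℝ, (∀ k, |β k| ≤ C) →
        p * ∑ k, h k (∑ j, M k j * β j) - ∑ k ∈ S, h k (∑ j, M k j * β j) ≤
          C * Λ / ρ * N * Real.sqrt (2 * (p * (1 - p))) + B * Real.sqrt m +
            B * Real.sqrt (2 * m * L)) fun S _ hS β hβ => by
      have a := (hDb S).le_ciSup ⟨β, hβ⟩
      change _ ≤ g S at a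
      have a' : p * ∑ k, h k (∑ j, M k j * β j) - ∑ k ∈ S, h k (∑ j, M k j * β j) ≤ g S := a
      have b := not_lt.1 hS
      linarith))
  linarith

/-- The main term for the sample fraction `m / N` exceeds the one for `f` by a factor of at most
`1 + 2 / N`. -/
theorem mul_sqrt_le_of_ceil {N m f : ℝ} (hN : 2 ≤ N) (hf : 0 < f) (hf2 : f ≤ 1 / 2)
    (hm1 : N * f ≤ m) (hm2 : m < N * f + 1) (hm : 1 ≤ m) (hu : 1 ≤ N - m) :
    N * Real.sqrt (f * (1 - f)) ≤ Real.sqrt (m * (N - m)) * (1 + 2 / N) := by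
  have hu1 : N - 1 ≤ m * (N - m) := by nlinarith
  have hu2 : N ^ 2 * (f * (1 - f)) - 1 ≤ m * (N - m) := by
    have h1 : 0 ≤ m - N * f := by linarith
    have h2 : 0 ≤ N * (1 - 2 * f) := mul_nonneg (by linarith) (by linarith)
    nlinarith [mul_nonneg h1 h2]
  have hN0 : 0 < N := by linarith
  have hprod : 0 ≤ m * (N - m) := by nlinarith
  have key : N ^ 2 * (f * (1 - f)) ≤ m * (N - m) * (1 + 2 / N) := by
    have : m * (N - m) * (1 + 2 / N) = m * (N - m) + 2 * (m * (N - m)) / N := by ring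
    rw [this]
    have : 1 ≤ 2 * (m * (N - m)) / N := by rw [le_div_iff₀ hN0]; linarith
    linarith
  have hone : 1 ≤ 1 + 2 / N := by linarith [div_pos (by norm_num : (0 : ℝ) < 2) hN0]
  have ha : 0 ≤ f * (1 - f) := mul_nonneg hf.le (by linarith)
  refine (sq_le_sq₀ (by positivity) (by positivity)).1 ?_
  rw [mul_pow, mul_pow, Real.sq_sqrt ha, Real.sq_sqrt hprod]
  refine key.trans (mul_le_mul_of_nonneg_left ?_ hprod)
  exact le_self_pow₀ hone (by norm_num)

theorem deviation_arith {N m f Y B L D : ℝ} (hN : 2 ≤ N) (hf : 0 < f) (hf2 : f ≤ 1 / 2)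
    (hm1 : N * f ≤ m) (hm2 : m < N * f + 1) (hm : 1 ≤ m) (hu : 1 ≤ N - m)
    (hu3 : N ≤ 3 * (N - m)) (hY : 0 ≤ Y) (hB : 0 < B)
    (hX : Real.sqrt 2 * Y / Real.sqrt (f * (1 - f)) ≤ B)
    (hD : D ≤ Y * N * Real.sqrt (2 * (m / N * (1 - m / N))) + B * Real.sqrt m +
      B * Real.sqrt (2 * m * L)) :
    N / (m * (N - m)) * D ≤ Real.sqrt 2 * Y / Real.sqrt (f * (1 - f)) +
      6 * B * (1 + Real.sqrt L) / ((1 - f) * Real.sqrt (N * f)) := by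
  have hN0 : 0 < N := by linarith
  have hu0 : 0 < N - m := by linarith
  have hm0 : 0 < m := by linarith
  have hNf : 0 < N * f := by positivity
  have hceil := mul_sqrt_le_of_ceil hN hf hf2 hm1 hm2 hm hu
  set a := Real.sqrt (f * (1 - f)) with ha
  set b := Real.sqrt (m * (N - m)) with hb
  have ha0 : 0 < a := Real.sqrt_pos.2 (mul_pos hf (by linarith))
  have hb0 : 0 < b := Real.sqrt_pos.2 (by positivity)
  have hb2 : b ^ 2 = m * (N - m) := Real.sq_sqrt (by positivity)
  set r := Real.sqrt m with hr
  have hr0 : 0 < r := Real.sqrt_pos.2 hm0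
  have hr2 : r ^ 2 = m := Real.sq_sqrt hm0.le
  set z := Real.sqrt (N * f) with hz
  have hz0 : 0 < z := Real.sqrt_pos.2 hNf
  have hzr : z ≤ r := Real.sqrt_le_sqrt hm1
  have hzN : z ≤ N := Real.sqrt_le_iff.2 ⟨hN0.le, by nlinarith⟩
  have hw : 0 ≤ Real.sqrt L := Real.sqrt_nonneg L
  have hs2 : Real.sqrt 2 ≤ 2 := Real.sqrt_le_iff.2 ⟨by norm_num, by norm_num⟩
  have e1 : Real.sqrt (2 * (m / N * (1 - m / N))) = Real.sqrt 2 * (b / N) := by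
    rw [Real.sqrt_mul (by norm_num)]
    congr 1
    rw [hb, show m / N * (1 - m / N) = m * (N - m) / N ^ 2 by field_simp,
      Real.sqrt_div (by positivity), Real.sqrt_sq hN0.le]
  have e2 : Real.sqrt (2 * m * L) = Real.sqrt 2 * r * Real.sqrt L := by
    rw [Real.sqrt_mul (by positivity), Real.sqrt_mul (by norm_num)]
  have hfac : 0 ≤ N / (m * (N - m)) := by positivity
  have t1 : N / (m * (N - m)) * (Y * N * Real.sqrt (2 * (m / N * (1 - m / N)))) ≤
      Real.sqrt 2 * Y / a + 2 * B / z := by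
    have h1 : N / (m * (N - m)) * (Y * N * Real.sqrt (2 * (m / N * (1 - m / N)))) =
        Real.sqrt 2 * Y * (N / b) := by
      rw [e1, ← hb2]; field_simp
    have h2 : N / b ≤ (1 + 2 / N) / a := by
      rw [div_le_div_iff₀ hb0 ha0]; linarith
    have h3 : 2 / N * B ≤ 2 * B / z := by
      rw [div_mul_eq_mul_div]; gcongr
    calc _ = Real.sqrt 2 * Y * (N / b) := h1
      _ ≤ Real.sqrt 2 * Y * ((1 + 2 / N) / a) := by gcongr
      _ = Real.sqrt 2 * Y / a + 2 / N * (Real.sqrt 2 * Y / a) := by ring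
      _ ≤ Real.sqrt 2 * Y / a + 2 / N * B := by gcongr
      _ ≤ _ := by linarith
  have hfr : N / (m * (N - m)) * r ≤ 3 / z := by
    have : N / (m * (N - m)) * r = N / (N - m) / r := by rw [← hr2]; field_simp
    rw [this]
    have : N / (N - m) ≤ 3 := by rw [div_le_iff₀ hu0]; exact hu3
    gcongr
  have t2 : N / (m * (N - m)) * (B * r) ≤ 3 * B / z := by
    calc _ = N / (m * (N - m)) * r * B := by ring
      _ ≤ 3 / z * B := by gcongr
      _ = _ := by ring
  have t3 : N / (m * (N - m)) * (B * Real.sqrt (2 * m * L)) ≤ 6 * B * Real.sqrt L / z := by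
    rw [e2]
    calc _ = N / (m * (N - m)) * r * (Real.sqrt 2 * B * Real.sqrt L) := by ring
      _ ≤ 3 / z * (2 * B * Real.sqrt L) := by gcongr
      _ = _ := by ring
  have hden : 6 * B * (1 + Real.sqrt L) / z ≤ 6 * B * (1 + Real.sqrt L) / ((1 - f) * z) := by
    have : 0 < 1 - f := by linarith
    gcongr
    nlinarith
  have hsum : 2 * B / z + 3 * B / z + 6 * B * Real.sqrt L / z ≤
      6 * B * (1 + Real.sqrt L) / z := by
    rw [← add_div, ← add_div]
    gcongr
    linarith
  have := mul_le_mul_of_nonneg_left hD hfac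
  rw [mul_add, mul_add] at this
  linarith

/-- generalization bound for Pref-Rank with the Kronecker-product
orthonormal embedding: there is a universal constant `C₁ > 0` such that, with
`K ∈ 𝒦(G)` and `K̃` the principal submatrix of `K ⊗ K` indexed by `𝒫_n`, with
probability at least `1 - δ` over a uniformly random `S ⊆ 𝒫_n` of size
`m = ⌈Nf⌉`, for all `F` in `{K̃β : ‖β‖_∞ ≤ C}` the test error is at most the
training error plus `√2 C λ1(K)/(ρ √(f(1-f))) + C₁B(1+√ln(1/δ))/((1-f)√(Nf))`. -/
theorem stmt_11 : ∃ C₁ : ℝ, 0 < C₁ ∧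
    ∀ (n : ℕ), 3 ≤ n →
    ∀ (G : SimpleGraph (Fin n)) (K : Matrix (Fin n) (Fin n) ℝ), K ∈ gramSet G →
    ∀ Ktil : Matrix (Pairs n) (Pairs n) ℝ,
      Ktil = (K ⊗ₖ K).submatrix (fun k : Pairs n => k.val) (fun k : Pairs n => k.val) →
    ∀ N : ℕ, N = Fintype.card (Pairs n) →
    ∀ y : Pairs n → ℝ, (∀ k, y k = 1 ∨ y k = -1) →
    ∀ f : ℝ, 0 < f → f ≤ 1 / 2 →
    ∀ m : ℕ, m = ⌈(N : ℝ) * f⌉₊ → m < N →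
    ∀ C : ℝ, 0 < C →
    ∀ ρ B : ℝ, 0 < ρ → 0 < B →
    ∀ ℓ : ℝ → ℝ → ℝ,
      (∀ a t, (a = 1 ∨ a = -1) → ℓ a t ∈ Set.Icc 0 B) →
      (∀ a t t', (a = 1 ∨ a = -1) → |ℓ a t - ℓ a t'| ≤ (1 / ρ) * |t - t'|) →
    ∀ δ : ℝ, 0 < δ → δ < 1 →
    (((Finset.powersetCard m (Finset.univ : Finset (Pairs n))).filter
        (fun S : Finset (Pairs n) =>
          ∀ β : Pairs n → ℝ, (∀ k, |β k| ≤ C) →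
            (1 / ((N : ℝ) - m)) * ∑ k ∈ Sᶜ, ℓ (y k) ((Ktil *ᵥ β) k) ≤
              (1 / (m : ℝ)) * ∑ k ∈ S, ℓ (y k) ((Ktil *ᵥ β) k) +
              Real.sqrt 2 * C * lam1 K / (ρ * Real.sqrt (f * (1 - f))) +
              C₁ * B * (1 + Real.sqrt (Real.log (1 / δ))) /
                ((1 - f) * Real.sqrt ((N : ℝ) * f)))).card : ℝ)
      ≥ (1 - δ) * ((Finset.powersetCard m (Finset.univ : Finset (Pairs n))).card : ℝ) := by
  refine ⟨6, by norm_num, ?_⟩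
  intro n _ G K hK Ktil hKtil N hN y hy f hf hf2 m hm hmN C hC ρ B hρ hB ℓ hℓ hlip δ hδ hδ1
  have hNpos : 0 < N := by omega
  have hNR : (0 : ℝ) < N := by exact_mod_cast hNpos
  have hm1 : (N : ℝ) * f ≤ m := by rw [hm]; exact Nat.le_ceil _
  have hm2 : (m : ℝ) < N * f + 1 := by rw [hm]; exact Nat.ceil_lt_add_one (by positivity)
  have hm0 : 0 < m := by rw [hm]; exact Nat.ceil_pos.2 (by positivity)
  have hmR : (1 : ℝ) ≤ m := by exact_mod_cast hm0
  have hN2 : (2 : ℝ) ≤ N := by exact_mod_cast (by omega : 2 ≤ N)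
  have hu : (1 : ℝ) ≤ N - m := by
    have : (m : ℝ) + 1 ≤ N := by exact_mod_cast hmN
    linarith
  have hu3 : (N : ℝ) ≤ 3 * (N - m) := by
    have h1 : (2 * m : ℝ) < N + 2 := by nlinarith
    have h2 : 2 * m < N + 2 := by exact_mod_cast h1
    have h3 : (2 * m : ℝ) ≤ N + 1 := by exact_mod_cast (by omega : 2 * m ≤ N + 1)
    linarith
  have hρa : 0 < ρ * Real.sqrt (f * (1 - f)) :=
    mul_pos hρ (Real.sqrt_pos.2 (mul_pos hf (by linarith)))
  obtain ⟨k₀⟩ : Nonempty (Pairs n) := Fintype.card_pos_iff.1 (hN ▸ hNpos)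
  have hlam : 0 < lam1 K := by
    have h1 := sum_sq_row_le hK.1 k₀.val.1
    have h2 := Finset.single_le_sum (f := fun j => K k₀.val.1 j ^ 2)
      (fun j _ => sq_nonneg _) (Finset.mem_univ k₀.val.1)
    simp only [hK.2.1, one_pow, mul_one] at h1 h2
    linarith
  have hrest : 0 ≤ 6 * B * (1 + Real.sqrt (Real.log (1 / δ))) /
      ((1 - f) * Real.sqrt ((N : ℝ) * f)) := by
    have : 0 ≤ 1 - f := by linarith
    positivity
  have hcompl : ∀ (S : Finset (Pairs n)), S ∈ powersetCard m univ → (#Sᶜ : ℝ) = N - m :=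
    fun S hS => by
      rw [card_compl, (mem_powersetCard.1 hS).2, ← hN, Nat.cast_sub hmN.le]
  have htriv : 0 ≤ (1 - δ) ∧ 1 - δ ≤ 1 := ⟨by linarith, by linarith⟩
  rcases le_or_gt B (Real.sqrt 2 * C * lam1 K / (ρ * Real.sqrt (f * (1 - f)))) with hX | hX
  · rw [Finset.filter_true_of_mem]
    · exact mul_le_of_le_one_left (Nat.cast_nonneg _) htriv.2
    · intro S hS β _
      have h1 : (1 / ((N : ℝ) - m)) * ∑ k ∈ Sᶜ, ℓ (y k) ((Ktil *ᵥ β) k) ≤ B := by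
        rw [one_div_mul_eq_div, div_le_iff₀ (by linarith), mul_comm, ← hcompl S hS,
          ← nsmul_eq_mul, ← Finset.sum_const]
        exact Finset.sum_le_sum fun k _ => (hℓ _ _ (hy k)).2
      have h2 : 0 ≤ (1 / (m : ℝ)) * ∑ k ∈ S, ℓ (y k) ((Ktil *ᵥ β) k) :=
        mul_nonneg (by positivity) (Finset.sum_nonneg fun k _ => (hℓ _ _ (hy k)).1)
      linarith
  · have hL : 0 ≤ Real.log (1 / δ) := Real.log_nonneg (by rw [le_div_iff₀ hδ]; linarith)
    have hrows : ∀ k, ∑ j, Ktil k j ^ 2 ≤ lam1 K ^ 2 := fun k => by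
      rw [hKtil]; exact sum_sq_row_kronecker_le hK k
    have hp : (m : ℝ) / N * Fintype.card (Pairs n) = m := by rw [← hN]; field_simp
    have key := card_filter_uniform_deviation_ge Ktil hlam hrows hC hρ hB hL
      (fun k t => ℓ (y k) t) (fun k t => hℓ _ t (hy k)) (fun k s t => hlip _ s t (hy k)) hm0
      (hN ▸ hmN) hp
    rw [one_div, Real.log_inv, neg_neg, Real.exp_log hδ, ← Real.log_inv, ← one_div, ← hN] at key
    refine key.trans (Nat.cast_le.2 (card_le_card fun S hS => ?_))
    rw [mem_filter] at hS ⊢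
    refine ⟨hS.1, fun β hβ => ?_⟩
    have hX' : Real.sqrt 2 * C * lam1 K / (ρ * Real.sqrt (f * (1 - f))) =
        Real.sqrt 2 * (C * lam1 K / ρ) / Real.sqrt (f * (1 - f)) := by
      field_simp
    have hdev := deviation_arith hN2 hf hf2 hm1 hm2 hmR hu hu3
      (by positivity : 0 ≤ C * lam1 K / ρ) hB (by rw [← hX']; exact hX.le) (hS.2 β hβ)
    rw [← hX'] at hdev
    have hsplit : (1 / ((N : ℝ) - m)) * ∑ k ∈ Sᶜ, ℓ (y k) ((Ktil *ᵥ β) k) =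
        (1 / (m : ℝ)) * ∑ k ∈ S, ℓ (y k) ((Ktil *ᵥ β) k) +
        (N : ℝ) / (m * (N - m)) * ((m : ℝ) / N * ∑ k, ℓ (y k) ((Ktil *ᵥ β) k) -
          ∑ k ∈ S, ℓ (y k) ((Ktil *ᵥ β) k)) := by
      rw [← Finset.sum_add_sum_compl S fun k => ℓ (y k) ((Ktil *ᵥ β) k)]
      have h1 : (N : ℝ) - m ≠ 0 := by linarith
      have h2 : (m : ℝ) ≠ 0 := by linarith
      field_simp
      ring
    rw [hsplit, add_assoc]
    exact add_le_add_right hdev _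
end
end
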